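/- arXiv:2412.17134 — 2 statements merged into one kernel-verified Lean document; each statement's English description precedes it below -/
import Mathlib

section
/- For any finite sets A of agents and G of items with |A| = |G| and any real utilities (u_{ij})_{i∈A, j∈G}, an HZ earnings equilibrium exists: there is an FPM x and earnings q ∈ ℝ^G, q ≥ 0, such that (x, q) is an HZ earnings equilibrium. -/
open Finset

/-- A fractional perfect matching. -/
def IsFPM {A G : Type*} [Fintype A] [Fintype G] (x : A → G → ℝ) : Prop :=
  (∀ i j, 0 ≤ x i j) ∧ (∀ i, ∑ j, x i j = 1) ∧ (∀ j, ∑ i, x i j = 1)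

/-- An HZ earnings equilibrium. -/
def IsHZEarningsEquilibrium {A G : Type*} [Fintype A] [Fintype G]
    (u : A → G → ℝ) (x : A → G → ℝ) (q : G → ℝ) : Prop :=
  IsFPM x ∧ (∀ j, 0 ≤ q j) ∧ (∀ i, 1 ≤ ∑ j, q j * x i j) ∧
  ∀ i, ∀ y : G → ℝ, (∀ j, 0 ≤ y j) → (∑ j, y j) = 1 → 1 ≤ (∑ j, q j * y j) →
    (∑ j, u i j * y j ≤ ∑ j, u i j * x i j) ∧
    ((∑ j, u i j * y j) = (∑ j, u i j * x i j) → ∑ j, q j * y j ≤ ∑ j, q j * x i j)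

section Brouwer

open Metric MeasureTheory
open scoped RealInnerProductSpace

variable {E : Type*} [NormedAddCommGroup E] [InnerProductSpace ℝ E] [FiniteDimensional ℝ E]

/-- Metric projection onto a nonempty closed convex set. -/
theorem exists_convex_projection {K : Set E} (hne : K.Nonempty) (hcl : IsClosed K)
    (hconv : Convex ℝ K) :
    ∃ P : E → E, LipschitzWith 1 P ∧ (∀ x, P x ∈ K) ∧
      ∀ x, ∀ w ∈ K, ⟪x - P x, w - P x⟫ ≤ 0 := by
  have h : ∀ u : E, ∃ v ∈ K, ∀ w ∈ K, ⟪u - v, w - v⟫ ≤ 0 := fun u => by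
    obtain ⟨v, hv, hmin⟩ := exists_norm_eq_iInf_of_complete_convex hne hcl.isComplete hconv u
    exact ⟨v, hv, (norm_eq_iInf_iff_real_inner_le_zero hconv hv).1 hmin⟩
  choose P hP hPi using h
  refine ⟨P, LipschitzWith.of_dist_le_mul fun x y => ?_, hP, hPi⟩
  have h1 := hPi x (P y) (hP y)
  have h2 := hPi y (P x) (hP x)
  have h3 : ‖P x - P y‖ ^ 2 ≤ ⟪x - y, P x - P y⟫ := by
    rw [← real_inner_self_eq_norm_sq]
    simp only [inner_sub_left, inner_sub_right] at h1 h2 ⊢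
    linarith
  have h4 := real_inner_le_norm (x - y) (P x - P y)
  rw [dist_eq_norm, dist_eq_norm, NNReal.coe_one, one_mul]
  by_contra! hlt
  have := norm_nonneg (x - y)
  nlinarith

theorem ContinuousLinearMap.det_one_add_pos {A : E →L[ℝ] E} (hA : ‖A‖ < 1) :
    0 < (1 + A).det := by
  have hne : ∀ s ∈ Set.Icc (0 : ℝ) 1, (1 + s • A).det ≠ 0 := by
    intro s hs
    have hn : ‖-(s • A)‖ < 1 := by
      rw [norm_neg, norm_smul, Real.norm_of_nonneg hs.1]
      nlinarith [hs.2, norm_nonneg A]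
    have hu : IsUnit (1 + s • A) := by
      simpa using (isUnit_one_sub_of_norm_lt_one hn)
    have := hu.map (ContinuousLinearMap.toLinearMapRingHom (R₁ := ℝ) (M₁ := E))
    exact (LinearMap.isUnit_det _ this).ne_zero
  have hcont : ContinuousOn (fun s : ℝ => (1 + s • A).det) (Set.Icc 0 1) :=
    (ContinuousLinearMap.continuous_det.comp (by fun_prop)).continuousOn
  by_contra! hle
  have h0 : (1 + (0 : ℝ) • A).det = 1 := by
    simp [ContinuousLinearMap.det]
  have := intermediate_value_Icc' (zero_le_one) hcont
  obtain ⟨s, hs, hs0⟩ := this (Set.mem_Icc.2 ⟨by simpa using hle, h0 ▸ zero_le_one⟩)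
  exact hne s hs hs0

theorem ContinuousLinearMap.det_one_add_eq_sum (A : E →L[ℝ] E) {v : ℕ → ℝ}
    (hv : Function.Injective v) :
    (1 + A).det = ∑ i ∈ range (Module.finrank ℝ E + 1),
      (1 + v i • A).det * (Lagrange.basis (range (Module.finrank ℝ E + 1)) v i).eval 1 := by
  classical
  let b := Module.finBasis ℝ E
  let M := LinearMap.toMatrix b b (A : E →ₗ[ℝ] E)
  let p : Polynomial ℝ := Matrix.det ((Polynomial.X : Polynomial ℝ) • M.map Polynomial.C
    + (1 : Matrix _ _ ℝ).map Polynomial.C)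
  have hp : ∀ t : ℝ, p.eval t = (1 + t • A).det := by
    intro t
    have e1 : p.eval t = (t • M + 1).det := by
      have := RingHom.map_det (Polynomial.evalRingHom t)
        ((Polynomial.X : Polynomial ℝ) • M.map Polynomial.C
          + (1 : Matrix _ _ ℝ).map Polynomial.C)
      simp only [Polynomial.coe_evalRingHom] at this
      rw [this]
      congr 1
      ext i j
      simp only [Matrix.map_apply, Matrix.add_apply, Matrix.smul_apply, smul_eq_mul,
        RingHom.mapMatrix_apply, Polynomial.coe_evalRingHom, Polynomial.eval_add,
        Polynomial.eval_mul, Polynomial.eval_X, Polynomial.eval_C]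
    rw [e1, ContinuousLinearMap.det, ← LinearMap.det_toMatrix b]
    congr 1
    simp [M, add_comm]
  have hdeg : p.degree < #(range (Module.finrank ℝ E + 1)) := by
    refine lt_of_le_of_lt Polynomial.degree_le_natDegree ?_
    have := Polynomial.natDegree_det_X_add_C_le M 1
    rw [Fintype.card_fin] at this
    rw [card_range]
    exact_mod_cast Nat.lt_succ_of_le this
  have key := Lagrange.eq_interpolate (hv.injOn) hdeg
  have := congrArg (Polynomial.eval 1) key
  rw [hp, one_smul, Lagrange.interpolate_apply, Polynomial.eval_finsetSum] at this
  simpa [hp] using this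

theorem no_contDiff_retraction (f : E → E) (hf : ∀ x ∈ closedBall (0 : E) 1, ContDiffAt ℝ 1 f x)
    (hnorm : ∀ x ∈ closedBall (0 : E) 1, ‖f x‖ = 1) (hid : ∀ x, ‖x‖ = 1 → f x = x) : False := by
  borelize E
  let μ : Measure E := Measure.addHaar
  obtain ⟨P, hPL, hPB, hPi⟩ := exists_convex_projection (K := closedBall (0 : E) 1)
    ⟨0, by simp⟩ isClosed_closedBall (convex_closedBall _ _)
  have hPid : ∀ x ∈ closedBall (0 : E) 1, P x = x := fun x hx => by
    have := hPi x x hx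
    rw [real_inner_self_eq_norm_sq] at this
    have h0 : ‖x - P x‖ = 0 := by nlinarith [norm_nonneg (x - P x)]
    exact (sub_eq_zero.1 (norm_eq_zero.1 h0)).symm
  have hPout : ∀ x, 1 < ‖x‖ → ‖P x‖ = 1 := fun x hx => by
    by_contra hne
    have hle : ‖P x‖ ≤ 1 := by simpa using hPB x
    have hlt : ‖P x‖ < 1 := lt_of_le_of_ne hle hne
    have hd : 0 < ‖x - P x‖ := by
      rw [norm_pos_iff, sub_ne_zero]
      rintro h
      rw [← h] at hlt
      linarith
    set c := (1 - ‖P x‖) / ‖x - P x‖ with hc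
    have hcpos : 0 < c := div_pos (by linarith) hd
    have := hPi x (P x + c • (x - P x)) (by
      rw [mem_closedBall_zero_iff]
      refine (norm_add_le _ _).trans ?_
      rw [norm_smul, Real.norm_of_nonneg hcpos.le, hc, div_mul_cancel₀ _ hd.ne']
      linarith)
    rw [add_sub_cancel_left, inner_smul_right, real_inner_self_eq_norm_sq] at this
    have : 0 < c * ‖x - P x‖ ^ 2 := by positivity
    linarith
  let g : E → E := fun x => f x - x
  have hg : ∀ x ∈ closedBall (0 : E) 1, ContDiffAt ℝ 1 g x := fun x hx =>
    (hf x hx).sub contDiffAt_id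
  obtain ⟨L, hL⟩ := ContDiffOn.exists_lipschitzOnWith
    (fun x hx => (hg x hx).contDiffWithinAt) one_ne_zero (convex_closedBall (0 : E) 1)
    (isCompact_closedBall (0 : E) 1)
  have hgP : LipschitzWith L (g ∘ P) := by
    have := hL.comp (hPL.lipschitzOnWith (s := Set.univ)) (fun x _ => hPB x)
    rw [mul_one] at this
    exact lipschitzOnWith_univ.1 this
  have hgP0 : ∀ x, 1 ≤ ‖x‖ → g (P x) = 0 := fun x hx => by
    have : ‖P x‖ = 1 := by
      rcases hx.eq_or_lt with h | h
      · rw [hPid x (by simp [← h]), ← h]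
      · exact hPout x h
    simp [g, hid _ this]
  have himage : ∀ t : ℝ, 0 ≤ t → t * L < 1 →
      Set.InjOn (fun x => x + t • g x) (ball 0 1) ∧
      (fun x => x + t • g x) '' (ball 0 1) = ball 0 1 := by
    intro t ht htL
    obtain ⟨k, hk⟩ : ∃ k : NNReal, (k : ℝ) = t * L := ⟨⟨t * L, by positivity⟩, rfl⟩
    have hlip : LipschitzWith k (fun x => t • g (P x)) := by
      refine LipschitzWith.of_dist_le_mul fun x y => ?_
      rw [dist_eq_norm, ← smul_sub, norm_smul, Real.norm_of_nonneg ht, ← dist_eq_norm]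
      have := hgP.dist_le_mul x y
      simp only [Function.comp] at this
      calc t * dist (g (P x)) (g (P y)) ≤ t * (L * dist x y) := by gcongr
        _ = _ := by rw [hk, mul_assoc]
    have hinj : Function.Injective (fun x => x + t • g (P x)) := by
      intro x y hxy
      have h1 := hlip.dist_le_mul x y
      simp only at hxy
      have h2 : t • g (P x) - t • g (P y) = y - x := by
        rw [sub_eq_sub_iff_add_eq_add, add_comm, hxy, add_comm]
      rw [dist_eq_norm, h2, ← dist_eq_norm, dist_comm, hk] at h1
      have h3 : dist x y = 0 := by nlinarith [dist_nonneg (x := x) (y := y)]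
      exact dist_eq_zero.1 h3
    have heq : ∀ x ∈ ball (0 : E) 1, x + t • g x = x + t • g (P x) := fun x hx => by
      rw [hPid x (ball_subset_closedBall hx)]
    refine ⟨(hinj.injOn).congr fun x hx => (heq x hx).symm, ?_⟩
    rw [Set.image_congr heq]
    apply Set.Subset.antisymm
    · rintro _ ⟨x, hx, rfl⟩
      by_contra hout
      set y := x + t • g (P x) with hy
      have hy1 : 1 ≤ ‖y‖ := by simpa using hout
      have : y + t • g (P y) = x + t • g (P x) := by rw [hgP0 y hy1]; simp [hy]
      rw [hinj this] at hy1
      rw [mem_ball_zero_iff] at hx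
      linarith
    · intro y hy
      have hc : ContractingWith k (fun x => y - t • g (P x)) := by
        refine ⟨?_, LipschitzWith.of_dist_le_mul fun a b => ?_⟩
        · rw [← NNReal.coe_lt_coe, hk]; exact htL
        · rw [dist_sub_left]; exact hlip.dist_le_mul a b
      have hfix := hc.fixedPoint_isFixedPt
      set x := ContractingWith.fixedPoint _ hc
      have hx : y - t • g (P x) = x := hfix
      have hxy : x + t • g (P x) = y := by nth_rw 1 [← hx]; exact sub_add_cancel _ _
      refine ⟨x, ?_, hxy⟩
      by_contra hout
      have hx1 : 1 ≤ ‖x‖ := by simpa using hout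
      rw [hgP0 x hx1, smul_zero, add_zero] at hxy
      exact hout (hxy ▸ hy)
  have hgd : ∀ x ∈ ball (0 : E) 1, HasFDerivAt g (fderiv ℝ g x) x := fun x hx =>
    ((hg x (ball_subset_closedBall hx)).differentiableAt one_ne_zero).hasFDerivAt
  have hgdL : ∀ x ∈ ball (0 : E) 1, ‖fderiv ℝ g x‖ ≤ L := fun x hx =>
    norm_fderiv_le_of_lipschitzOn ℝ (Filter.mem_of_superset (isOpen_ball.mem_nhds hx)
      ball_subset_closedBall) hL
  have hvol : ∀ t : ℝ, 0 ≤ t → t * L < 1 →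
      IntegrableOn (fun x => (1 + t • fderiv ℝ g x).det) (ball 0 1) μ ∧
      ∫ x in ball 0 1, (1 + t • fderiv ℝ g x).det ∂μ = μ.real (ball 0 1) := by
    intro t ht htL
    obtain ⟨hinj, him⟩ := himage t ht htL
    have hder : ∀ x ∈ ball (0 : E) 1, HasFDerivWithinAt (fun x => x + t • g x)
        (1 + t • fderiv ℝ g x) (ball 0 1) x := fun x hx =>
      ((hasFDerivAt_id x).add ((hgd x hx).const_smul t)).hasFDerivWithinAt
    have hpos : ∀ x ∈ ball (0 : E) 1, 0 < (1 + t • fderiv ℝ g x).det := fun x hx => by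
      apply ContinuousLinearMap.det_one_add_pos
      rw [norm_smul, Real.norm_of_nonneg ht]
      exact lt_of_le_of_lt (by gcongr; exact hgdL x hx) htL
    have key := integral_image_eq_integral_abs_det_fderiv_smul μ measurableSet_ball hder hinj
      (fun _ => (1 : ℝ))
    have keyi := (integrableOn_image_iff_integrableOn_abs_det_fderiv_smul μ measurableSet_ball
      hder hinj (fun _ => (1 : ℝ))).1 (by rw [him]; simp [measure_ball_lt_top])
    have hcongr : Set.EqOn (fun x => |(1 + t • fderiv ℝ g x).det| • (1 : ℝ))
        (fun x => (1 + t • fderiv ℝ g x).det) (ball 0 1) := fun x hx => by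
      simp [abs_of_pos (hpos x hx)]
    rw [him, setIntegral_congr_fun measurableSet_ball hcongr] at key
    exact ⟨keyi.congr_fun hcongr measurableSet_ball, by rw [← key]; simp⟩
  have hdet0 : ∀ x ∈ ball (0 : E) 1, (1 + fderiv ℝ g x).det = 0 := by
    intro x hx
    have hfx : HasFDerivAt f (1 + fderiv ℝ g x) x := by
      have := (hasFDerivAt_id x).add (hgd x hx)
      refine this.congr_of_eventuallyEq (Filter.Eventually.of_forall fun y => ?_)
      simp [g]
    have hsq := hfx.norm_sq
    have hconst : (fun y => ‖f y‖ ^ 2) =ᶠ[nhds x] fun _ => (1 : ℝ) := by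
      filter_upwards [isOpen_ball.mem_nhds hx] with y hy
      rw [hnorm y (ball_subset_closedBall hy), one_pow]
    have hz := hsq.unique ((hasFDerivAt_const (1 : ℝ) x).congr_of_eventuallyEq hconst)
    by_contra hdet
    have hsurj : Function.Surjective (1 + fderiv ℝ g x : E →L[ℝ] E) := by
      have := (LinearMap.equivOfDetNeZero _ hdet).surjective
      exact this
    obtain ⟨v, hv⟩ := hsurj (f x)
    have := DFunLike.congr_fun hz v
    simp only [smul_apply, ContinuousLinearMap.comp_apply, hv,
      innerSL_apply_apply, real_inner_self_eq_norm_sq, hnorm x (ball_subset_closedBall hx)] at this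
    norm_num at this
  let v : ℕ → ℝ := fun i => 1 / ((i + 1) * (L + 1))
  have hv : Function.Injective v := by
    intro i j hij
    have hL1 : (0 : ℝ) < L + 1 := by positivity
    simp only [v, one_div, inv_inj] at hij
    have := mul_right_cancel₀ hL1.ne' hij
    exact_mod_cast add_right_cancel this
  have hv0 : ∀ i, 0 ≤ v i := fun i => by positivity
  have hvL : ∀ i, v i * L < 1 := fun i => by
    simp only [v]
    rw [one_div, inv_mul_lt_iff₀ (by positivity), mul_one]
    have : (0 : ℝ) ≤ L := L.2
    have : (0 : ℝ) ≤ i := by positivity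
    nlinarith
  set s := range (Module.finrank ℝ E + 1)
  have hintegral : ∫ x in ball (0 : E) 1, (1 + fderiv ℝ g x).det ∂μ = μ.real (ball 0 1) := by
    simp_rw [fun x => ContinuousLinearMap.det_one_add_eq_sum (fderiv ℝ g x) hv]
    rw [integral_finsetSum _ fun i _ => ((hvol _ (hv0 i) (hvL i)).1.mul_const _)]
    simp_rw [integral_mul_const, (hvol _ (hv0 _) (hvL _)).2]
    rw [← mul_sum, ← Polynomial.eval_finsetSum, Lagrange.sum_basis hv.injOn (by simp)]
    simp
  rw [setIntegral_congr_fun measurableSet_ball (g := fun _ => (0 : ℝ)) hdet0] at hintegral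
  have hpos : 0 < μ.real (ball (0 : E) 1) :=
    ENNReal.toReal_pos (measure_ball_pos μ 0 one_pos).ne' measure_ball_lt_top.ne
  simp at hintegral
  linarith

theorem exists_fixedPoint_unitBall {f : E → E} (hf : Continuous f)
    (hmaps : Set.MapsTo f (closedBall 0 1) (closedBall 0 1)) :
    ∃ x ∈ closedBall (0 : E) 1, f x = x := by
  by_contra! hno
  obtain ⟨x₀, hx₀, hmin⟩ := (isCompact_closedBall (0 : E) 1).exists_isMinOn ⟨0, by simp⟩
    ((hf.sub continuous_id).norm.continuousOn)
  have hδ : 0 < ‖f x₀ - x₀‖ := norm_pos_iff.2 (sub_ne_zero.2 (hno x₀ hx₀))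
  obtain ⟨ε, hε, hεδ⟩ : ∃ ε : ℝ, 0 < ε ∧ 3 * ε = ‖f x₀ - x₀‖ := ⟨‖f x₀ - x₀‖ / 3, by positivity,
    by ring⟩
  obtain ⟨g, hg, hgf, -⟩ := hf.exists_contDiff_approx 1 (continuous_const (y := ε)) fun _ => hε
  set c : ℝ := (1 + 2 * ε)⁻¹ with hc
  have hc0 : 0 < c := by positivity
  have hc1 : c * (1 + 2 * ε) = 1 := inv_mul_cancel₀ (by positivity)
  let p : E → E := fun x => c • g x
  have hp : ContDiff ℝ 1 p := contDiff_const.smul hg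
  have hgn : ∀ x ∈ closedBall (0 : E) 1, ‖g x‖ < 1 + ε := fun x hx => by
    have h1 : ‖f x‖ ≤ 1 := by simpa using hmaps hx
    have h2 := hgf x
    rw [dist_eq_norm] at h2
    have h3 := norm_sub_norm_le (g x) (f x)
    linarith
  have hpn : ∀ x ∈ closedBall (0 : E) 1, ‖p x‖ < 1 := fun x hx => by
    simp only [p]
    rw [norm_smul, Real.norm_of_nonneg hc0.le]
    nlinarith [hgn x hx]
  have hpx : ∀ x ∈ closedBall (0 : E) 1, x - p x ≠ 0 := fun x hx h0 => by
    have h1 : ‖f x₀ - x₀‖ ≤ ‖f x - x‖ := hmin hx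
    have h2 := hgf x
    rw [dist_comm, dist_eq_norm] at h2
    have h3 : ‖g x - p x‖ ≤ 2 * ε := by
      have : g x - p x = (1 - c) • g x := by simp [p, sub_smul]
      rw [this, norm_smul, Real.norm_of_nonneg (by nlinarith)]
      have := hgn x hx
      have hcc : 1 - c = c * (2 * ε) := by linarith
      rw [hcc]
      nlinarith [mul_pos hc0 hε, norm_nonneg (g x)]
    have h4 : f x - x = (f x - g x) + (g x - p x) := by
      rw [← sub_eq_zero.1 h0]; abel_nf
    have h5 := norm_add_le (f x - g x) (g x - p x)
    rw [← h4] at h5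
    linarith
  let d : E → E := fun x => x - p x
  let b : E → ℝ := fun x => ⟪x, d x⟫
  let D : E → ℝ := fun x => b x ^ 2 + ‖d x‖ ^ 2 * (1 - ‖x‖ ^ 2)
  let r : E → E := fun x => x + ((-b x + √(D x)) / ‖d x‖ ^ 2) • d x
  have hd : ContDiff ℝ 1 d := contDiff_id.sub hp
  have hb : ContDiff ℝ 1 b := contDiff_id.inner ℝ hd
  have hD : ContDiff ℝ 1 D :=
    (hb.pow 2).add ((hd.norm_sq ℝ).mul (contDiff_const.sub (contDiff_id.norm_sq ℝ)))
  have hbpos : ∀ x, ‖x‖ = 1 → 0 < b x := fun x hx => by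
    have h1 := hpn x (by simp [hx])
    have h2 := real_inner_le_norm x (p x)
    simp only [b, d, inner_sub_right, real_inner_self_eq_norm_sq, hx]
    rw [hx] at h2
    linarith
  have hDpos : ∀ x ∈ closedBall (0 : E) 1, 0 < D x := fun x hx => by
    have hx1 : ‖x‖ ≤ 1 := by simpa using hx
    have hdx : 0 < ‖d x‖ := norm_pos_iff.2 (hpx x hx)
    rcases hx1.eq_or_lt with h | h
    · have := hbpos x h
      simp only [D, h]
      norm_num
      positivity
    · have : 0 < 1 - ‖x‖ ^ 2 := by nlinarith [norm_nonneg x]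
      simp only [D]
      positivity
  refine no_contDiff_retraction r (fun x hx => ?_) (fun x hx => ?_) (fun x hx => ?_)
  · have hdx : ‖d x‖ ^ 2 ≠ 0 := by
      have := norm_pos_iff.2 (hpx x hx)
      positivity
    exact contDiffAt_id.add ((((hb.contDiffAt.neg).add (hD.contDiffAt.sqrt (hDpos x hx).ne')).div
      (hd.norm_sq ℝ).contDiffAt hdx).smul hd.contDiffAt)
  · have hdx : ‖d x‖ ≠ 0 := norm_ne_zero_iff.2 (hpx x hx)
    have hs := Real.sq_sqrt (hDpos x hx).le
    have h2 : ‖r x‖ ^ 2 = 1 := by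
      simp only [r]
      rw [norm_add_sq_real, norm_smul, mul_pow, inner_smul_right, Real.norm_eq_abs, sq_abs]
      change ‖x‖ ^ 2 + 2 * (_ * b x) + _ = 1
      field_simp
      have : D x = b x ^ 2 + ‖d x‖ ^ 2 * (1 - ‖x‖ ^ 2) := rfl
      linear_combination hs + this
    nlinarith [norm_nonneg (r x)]
  · have : D x = b x ^ 2 := by simp [D, hx]
    simp only [r]
    rw [this, Real.sqrt_sq (hbpos x hx).le]
    simp

/-- The Hartman–Stampacchia theorem: variational inequalities on compact convex sets are
solvable. -/
theorem exists_variational_inequality {K : Set E} (hne : K.Nonempty) (hK : IsCompact K)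
    (hconv : Convex ℝ K) {F : E → E} (hF : Continuous F) :
    ∃ x ∈ K, ∀ y ∈ K, ⟪F x, y - x⟫ ≤ 0 := by
  obtain ⟨P, hPL, hPK, hPi⟩ := exists_convex_projection hne hK.isClosed hconv
  obtain ⟨R, hR, hKR⟩ := hK.isBounded.exists_pos_norm_le
  have hcont : Continuous fun y : E => R⁻¹ • P (R • y + F (R • y)) := by
    have := hPL.continuous
    fun_prop
  obtain ⟨y, -, hy⟩ := exists_fixedPoint_unitBall hcont (fun y _ => by
    rw [mem_closedBall_zero_iff, norm_smul, norm_inv, Real.norm_of_nonneg hR.le,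
      inv_mul_le_iff₀ hR, mul_one]
    exact hKR _ (hPK _))
  have hx : P (R • y + F (R • y)) = R • y := by
    nth_rw 3 [← hy]
    rw [smul_inv_smul₀ hR.ne']
  refine ⟨R • y, hx ▸ hPK _, fun w hw => ?_⟩
  have := hPi (R • y + F (R • y)) w hw
  rwa [hx, add_sub_cancel_left] at this

theorem exists_variational_inequality_pi {ι : Type*} [Fintype ι] {K : Set (ι → ℝ)}
    (hne : K.Nonempty) (hK : IsCompact K) (hconv : Convex ℝ K) {F : (ι → ℝ) → ι → ℝ}
    (hF : Continuous F) : ∃ x ∈ K, ∀ y ∈ K, ∑ i, F x i * (y i - x i) ≤ 0 := by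
  let e := EuclideanSpace.equiv ι ℝ
  obtain ⟨x, hx, h⟩ := exists_variational_inequality (K := e.symm '' K) (hne.image _)
    (hK.image e.symm.continuous) (hconv.linear_image e.symm.toLinearMap)
    (F := fun x => e.symm (F (e x))) (by fun_prop)
  obtain ⟨x, hxK, rfl⟩ := hx
  refine ⟨x, hxK, fun y hy => ?_⟩
  have := h _ ⟨y, hy, rfl⟩
  change ⟪e.symm (F (e (e.symm x))), e.symm y - e.symm x⟫ ≤ 0 at this
  rw [e.apply_symm_apply] at this
  simpa [e, PiLp.inner_apply, mul_comm] using this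

end Brouwer

section Equilibrium

theorem Fintype.sum_mul_update_sub {ι : Type*} [Fintype ι] [DecidableEq ι] (c f : ι → ℝ) (i : ι)
    (v : ℝ) : ∑ k, c k * (Function.update f i v k - f k) = c i * (v - f i) := by
  rw [Finset.sum_eq_single i (fun k _ hk => by simp [hk]) (by simp), Function.update_self]

variable {A G : Type*} [Fintype A] [Fintype G]

/-- The variational inequality of the game in which agents choose bundles `x` and multipliers `μ`
and the market chooses prices `r`. -/
theorem exists_market_variational_inequality [Nonempty G] (u : A → G → ℝ) {ε M L : ℝ}
    (hM : ε ≤ M) (hL : -1 ≤ L) :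
    ∃ (x : A → G → ℝ) (μ : A → ℝ) (r : G → ℝ),
      (∀ i j, 0 ≤ x i j) ∧ (∀ i, ∑ j, x i j = 1) ∧ (∀ i, μ i ∈ Set.Icc ε M) ∧
      (∀ j, r j ∈ Set.Icc (-1) L) ∧
      ∀ (y : A → G → ℝ) (ν : A → ℝ) (s : G → ℝ),
        (∀ i j, 0 ≤ y i j) → (∀ i, ∑ j, y i j = 1) → (∀ i, ν i ∈ Set.Icc ε M) →
        (∀ j, s j ∈ Set.Icc (-1) L) →
        ∑ i, ∑ j, (u i j - μ i * r j) * (y i j - x i j) +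
          (∑ i, (∑ j, r j * x i j) * (ν i - μ i) +
            ∑ j, (∑ i, x i j - 1 - ε) * (s j - r j)) ≤ 0 := by
  classical
  let lo : (A × G) ⊕ A ⊕ G → ℝ := Sum.elim (fun _ => 0) (Sum.elim (fun _ => ε) fun _ => -1)
  let hi : (A × G) ⊕ A ⊕ G → ℝ := Sum.elim (fun _ => 1) (Sum.elim (fun _ => M) fun _ => L)
  let mk : (A → G → ℝ) → (A → ℝ) → (G → ℝ) → ((A × G) ⊕ A ⊕ G → ℝ) := fun y ν s =>
    Sum.elim (fun p => y p.1 p.2) (Sum.elim ν s)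
  let K : Set ((A × G) ⊕ A ⊕ G → ℝ) := Set.Icc lo hi ∩ {z | ∀ i, ∑ j, z (Sum.inl (i, j)) = 1}
  have hmk : ∀ (y : A → G → ℝ) (ν : A → ℝ) (s : G → ℝ),
      (∀ i j, 0 ≤ y i j) → (∀ i, ∑ j, y i j = 1) → (∀ i, ν i ∈ Set.Icc ε M) →
      (∀ j, s j ∈ Set.Icc (-1) L) → mk y ν s ∈ K := by
    intro y ν s hy hy1 hν hs
    refine ⟨⟨?_, ?_⟩, hy1⟩
    · rintro (⟨i, j⟩ | i | j)
      exacts [hy i j, (hν i).1, (hs j).1]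
    · rintro (⟨i, j⟩ | i | j)
      exacts [(single_le_sum (fun k _ => hy i k) (mem_univ j)).trans_eq (hy1 i), (hν i).2, (hs j).2]
  have hcl : IsClosed {z : (A × G) ⊕ A ⊕ G → ℝ | ∀ i, ∑ j, z (Sum.inl (i, j)) = 1} := by
    simp only [Set.ofPred_forall]
    exact isClosed_iInter fun i => isClosed_eq (by fun_prop) continuous_const
  have hcv : Convex ℝ {z : (A × G) ⊕ A ⊕ G → ℝ | ∀ i, ∑ j, z (Sum.inl (i, j)) = 1} := by
    intro z hz w hw a b _ _ hab i
    simp [sum_add_distrib, ← mul_sum, hz i, hw i, hab]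
  have hne : K.Nonempty := by
    obtain ⟨g⟩ := ‹Nonempty G›
    refine ⟨_, hmk (fun _ => Pi.single g 1) (fun _ => ε) (fun _ => -1) (fun i j => ?_) (fun i => ?_)
      (fun _ => ⟨le_rfl, hM⟩) (fun _ => ⟨le_rfl, hL⟩)⟩
    · by_cases h : j = g
      · subst h; simp
      · simp [h]
    · simp
  obtain ⟨z, hz, h⟩ := exists_variational_inequality_pi (K := K) hne (isCompact_Icc.inter_right hcl)
    ((convex_Icc _ _).inter hcv)
    (F := fun z => mk (fun i j => u i j - z (Sum.inr (Sum.inl i)) * z (Sum.inr (Sum.inr j)))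
      (fun i => ∑ j, z (Sum.inr (Sum.inr j)) * z (Sum.inl (i, j)))
      (fun j => ∑ i, z (Sum.inl (i, j)) - 1 - ε)) (by
      refine continuous_pi ?_
      rintro (⟨i, j⟩ | i | j) <;> simp only [mk, Sum.elim_inl, Sum.elim_inr] <;> fun_prop)
  refine ⟨fun i j => z (Sum.inl (i, j)), fun i => z (Sum.inr (Sum.inl i)),
    fun j => z (Sum.inr (Sum.inr j)), fun i j => hz.1.1 (Sum.inl (i, j)), hz.2,
    fun i => ⟨hz.1.1 (Sum.inr (Sum.inl i)), hz.1.2 (Sum.inr (Sum.inl i))⟩,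
    fun j => ⟨hz.1.1 (Sum.inr (Sum.inr j)), hz.1.2 (Sum.inr (Sum.inr j))⟩,
    fun y ν s hy hy1 hν hs => ?_⟩
  have := h _ (hmk y ν s hy hy1 hν hs)
  simpa only [Fintype.sum_sum_type, Fintype.sum_prod_type, mk, Sum.elim_inl, Sum.elim_inr]
    using this

/-- Equilibria of the market in which every multiplier is at least `ε` and every item may be
oversold by `ε`. -/
theorem exists_approximate_equilibrium [Nonempty G] (hcard : Fintype.card A = Fintype.card G)
    (u : A → G → ℝ) {U ε : ℝ} (hU : ∀ i j k, u i j - u i k ≤ U) (hU0 : 0 ≤ U) (hε : 0 < ε)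
    (hε1 : ε ≤ 1) :
    ∃ (x : A → G → ℝ) (μ : A → ℝ) (r : G → ℝ),
      (∀ i j, 0 ≤ x i j) ∧ (∀ i, ∑ j, x i j = 1) ∧ (∀ i, μ i ∈ Set.Icc ε (U + 1)) ∧
      (∀ j, r j ∈ Set.Icc (-1) (Fintype.card G : ℝ)) ∧
      (∀ i j k, 0 < x i j → u i k - μ i * r k ≤ u i j - μ i * r j) ∧
      (∀ i, ∑ j, r j * x i j ≤ 0) ∧ (∀ i, ε < μ i → 0 ≤ ∑ j, r j * x i j) ∧
      ∀ j, ∑ i, x i j ≤ 1 + ε := by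
  classical
  have hn : (0 : ℝ) ≤ Fintype.card G := Nat.cast_nonneg _
  obtain ⟨x, μ, r, hx, hx1, hμ, hr, H⟩ := exists_market_variational_inequality u
    (show ε ≤ U + 1 by linarith) (show (-1 : ℝ) ≤ Fintype.card G by linarith)
  have hbundle : ∀ i j k, x i j * (u i k - μ i * r k) ≤ x i j * (u i j - μ i * r j) := by
    intro i j k
    let row : G → ℝ := fun l => x i l + x i j * ((if l = k then 1 else 0) - if l = j then 1 else 0)
    have := H (Function.update x i row) μ r (fun i' l => ?_) (fun i' => ?_) hμ hr
    · simp only [sub_self, mul_zero, sum_const_zero, add_zero] at this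
      rw [Finset.sum_eq_single i (fun i' _ hi' => by simp [hi']) (by simp)] at this
      have e : ∀ l, (u i l - μ i * r l) * (Function.update x i row i l - x i l) =
          x i j * ((if l = k then u i l - μ i * r l else 0) -
            if l = j then u i l - μ i * r l else 0) := by
        intro l
        simp only [Function.update_self, row]
        split_ifs <;> ring
      simp only [e, ← mul_sum, sum_sub_distrib, sum_ite_eq', mem_univ, if_true] at this
      linarith
    · by_cases hi : i' = i
      · subst hi
        simp only [Function.update_self, row]
        have h1 := hx i' l
        have h2 := hx i' j
        split_ifs with h3 h4 h4
        · simpa using h1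
        · linarith
        · subst h4; linarith
        · simpa using h1
      · simpa [hi] using hx i' l
    · by_cases hi : i' = i
      · subst hi
        simp [row, sum_add_distrib, ← mul_sum, hx1]
      · simpa [hi] using hx1 i'
  have hmult : ∀ i, ∀ v ∈ Set.Icc ε (U + 1), (∑ j, r j * x i j) * (v - μ i) ≤ 0 := by
    intro i v hv
    have := H x (Function.update μ i v) r hx hx1 (fun k => by
      by_cases hk : k = i
      · subst hk; simpa using hv
      · simpa [hk] using hμ k) hr
    rw [Fintype.sum_mul_update_sub (fun i => ∑ j, r j * x i j)] at this
    simpa using this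
  have hprice : ∀ j, ∀ v ∈ Set.Icc (-1) (Fintype.card G : ℝ),
      (∑ i, x i j - 1 - ε) * (v - r j) ≤ 0 := by
    intro j v hv
    have := H x μ (Function.update r j v) hx hx1 hμ (fun k => by
      by_cases hk : k = j
      · subst hk; simpa using hv
      · simpa [hk] using hr k)
    rw [Fintype.sum_mul_update_sub (fun j => ∑ i, x i j - 1 - ε)] at this
    simpa using this
  have hlow : ∀ j, ∑ i, x i j - 1 < ε → r j = -1 := fun j hj => by
    have h1 := hprice j (-1) ⟨le_rfl, by linarith⟩
    have h2 := (hr j).1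
    nlinarith
  have hzsum : ∑ j, (∑ i, x i j - 1) = 0 := by
    rw [sum_sub_distrib, sum_comm]
    simp [hx1, hcard]
  obtain ⟨k, hk⟩ : ∃ k, r k = -1 := by
    obtain ⟨k, -, hk⟩ := exists_le_of_sum_le (s := univ) (g := fun _ : G => (0 : ℝ))
      univ_nonempty (by rw [hzsum]; simp)
    exact ⟨k, hlow k (by linarith)⟩
  have hbudget : ∀ i, ∑ j, r j * x i j ≤ 0 := by
    intro i
    by_contra! hpos
    have hμM : μ i = U + 1 := by
      have h1 := hmult i (U + 1) ⟨by linarith, le_rfl⟩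
      have h2 := (hμ i).2
      nlinarith
    have h1 : ∑ j, x i j * (u i k - μ i * r k) ≤ ∑ j, x i j * (u i j - μ i * r j) :=
      sum_le_sum fun j _ => hbundle i j k
    have h2 : ∑ j, x i j * (u i j - u i k) ≤ ∑ j, x i j * U :=
      sum_le_sum fun j _ => mul_le_mul_of_nonneg_left (hU i j k) (hx i j)
    have h3 : ∑ j, x i j * (u i j - μ i * r j) =
        ∑ j, x i j * (u i j - u i k) + u i k * ∑ j, x i j - μ i * ∑ j, r j * x i j := by
      rw [mul_sum, mul_sum, ← sum_add_distrib, ← sum_sub_distrib]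
      exact sum_congr rfl fun j _ => by ring
    rw [h3, ← sum_mul, hx1, hk, hμM] at h1
    rw [← sum_mul, hx1] at h2
    nlinarith
  refine ⟨x, μ, r, hx, hx1, hμ, hr, fun i j k hj => le_of_mul_le_mul_left (hbundle i j k) hj,
    hbudget, fun i hi => ?_, fun j => ?_⟩
  · have := hmult i ε ⟨le_rfl, by linarith⟩
    nlinarith
  · by_contra! hj
    have hrj : (Fintype.card G : ℝ) ≤ r j := by
      have := hprice j (Fintype.card G) ⟨by linarith, le_rfl⟩
      nlinarith
    have h1 : 0 ≤ ∑ l, (r l + 1) * (∑ i, x i l - 1) := sum_nonneg fun l _ => by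
      rcases lt_or_ge (∑ i, x i l - 1) ε with h | h
      · rw [hlow l h]; simp
      · exact mul_nonneg (by linarith [(hr l).1]) (by linarith)
    have h2 : ∑ l, (r l + 1) * (∑ i, x i l - 1) =
        ∑ i, ∑ l, r l * x i l - ∑ l, r l + ∑ l, (∑ i, x i l - 1) := by
      rw [sum_comm, ← sum_sub_distrib, ← sum_add_distrib]
      exact sum_congr rfl fun l _ => by rw [← mul_sum]; ring
    have h3 : ∑ i, ∑ l, r l * x i l ≤ 0 := sum_nonpos fun i _ => hbudget i
    have h4 : r j + 1 ≤ ∑ l, (r l + 1) :=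
      single_le_sum (f := fun l => r l + 1) (fun l _ => by linarith [(hr l).1]) (mem_univ j)
    rw [sum_add_distrib] at h4
    simp only [sum_const, card_univ, nsmul_eq_mul, mul_one] at h4
    rw [hzsum] at h2
    linarith

open Filter Topology in
/-- A complementarity form of equilibrium: `r` are prices with budget zero and `μ i` is the
Lagrange multiplier of the budget constraint of agent `i`. -/
theorem exists_complementary_equilibrium [Nonempty G] (hcard : Fintype.card A = Fintype.card G)
    (u : A → G → ℝ) :
    ∃ (x : A → G → ℝ) (μ : A → ℝ) (r : G → ℝ),
      IsFPM x ∧ (∀ i, 0 ≤ μ i) ∧ (∀ j, r j ≤ Fintype.card G) ∧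
      (∀ i j k, 0 < x i j → u i k - μ i * r k ≤ u i j - μ i * r j) ∧
      (∀ i, ∑ j, r j * x i j ≤ 0) ∧ (∀ i, 0 < μ i → ∑ j, r j * x i j = 0) ∧
      ∀ i j k, 0 < x i j → u i j ≤ u i k → r j ≤ r k := by
  obtain ⟨U, hU0, hU⟩ : ∃ U : ℝ, 0 ≤ U ∧ ∀ i j k, u i j - u i k ≤ U := by
    obtain ⟨U, hU⟩ := (Set.finite_range fun p : A × G × G => u p.1 p.2.1 - u p.1 p.2.2).bddAbove
    exact ⟨max U 0, le_max_right _ _, fun i j k =>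
      (hU ⟨(i, j, k), rfl⟩).trans (le_max_left _ _)⟩
  let ε : ℕ → ℝ := fun m => 1 / ((m : ℝ) + 1)
  have hε0 : ∀ m, 0 < ε m := fun m => by positivity
  have hε1 : ∀ m, ε m ≤ 1 := fun m => by
    simp only [ε]
    rw [div_le_one (by positivity)]
    linarith [(Nat.cast_nonneg m : (0 : ℝ) ≤ m)]
  choose x μ r hx hx1 hμ hr hopt hb hb' hz using fun m =>
    exists_approximate_equilibrium hcard u hU hU0 (hε0 m) (hε1 m)
  have hcomp : IsCompact (Set.Icc (0 : A → G → ℝ) 1 ×ˢ (Set.Icc (0 : A → ℝ) (fun _ => U + 1) ×ˢ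
      Set.Icc (fun _ : G => (-1 : ℝ)) (fun _ => (Fintype.card G : ℝ)))) :=
    isCompact_Icc.prod (isCompact_Icc.prod isCompact_Icc)
  obtain ⟨⟨x', μ', r'⟩, hmem, φ, hφ, hlim⟩ := hcomp.tendsto_subseq
    (x := fun m => (x m, μ m, r m)) (fun m =>
      ⟨⟨fun i j => hx m i j, fun i j =>
          (single_le_sum (fun k _ => hx m i k) (mem_univ j)).trans_eq (hx1 m i)⟩,
        ⟨fun i => (hε0 m).le.trans (hμ m i).1, fun i => (hμ m i).2⟩,
        ⟨fun j => (hr m j).1, fun j => (hr m j).2⟩⟩)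
  obtain ⟨⟨hx'0, -⟩, ⟨hμ'0, -⟩, ⟨-, hr'n⟩⟩ := hmem
  have hlx : ∀ i j, Tendsto (fun m => x (φ m) i j) atTop (𝓝 (x' i j)) := fun i j =>
    tendsto_pi_nhds.1 (tendsto_pi_nhds.1 hlim.fst_nhds i) j
  have hlμ : ∀ i, Tendsto (fun m => μ (φ m) i) atTop (𝓝 (μ' i)) := fun i =>
    tendsto_pi_nhds.1 hlim.snd_nhds.fst_nhds i
  have hlr : ∀ j, Tendsto (fun m => r (φ m) j) atTop (𝓝 (r' j)) := fun j =>
    tendsto_pi_nhds.1 hlim.snd_nhds.snd_nhds j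
  have hlε : Tendsto (fun m => ε (φ m)) atTop (𝓝 0) :=
    tendsto_one_div_add_atTop_nhds_zero_nat.comp hφ.tendsto_atTop
  have hlb : ∀ i, Tendsto (fun m => ∑ j, r (φ m) j * x (φ m) i j) atTop
      (𝓝 (∑ j, r' j * x' i j)) := fun i =>
    tendsto_finsetSum _ fun j _ => (hlr j).mul (hlx i j)
  have hrow : ∀ i, ∑ j, x' i j = 1 := fun i =>
    tendsto_nhds_unique (tendsto_finsetSum _ fun j _ => hlx i j)
      (by simp only [hx1]; exact tendsto_const_nhds)
  have hcol_le : ∀ j, ∑ i, x' i j ≤ 1 := fun j => by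
    have := le_of_tendsto_of_tendsto' (tendsto_finsetSum univ fun i _ => hlx i j)
      (hlε.const_add 1) fun m => hz (φ m) j
    simpa using this
  have hcol : ∀ j, ∑ i, x' i j = 1 := by
    have hs : ∑ j, ∑ i, x' i j = ∑ _j : G, (1 : ℝ) := by
      rw [sum_comm]
      simp [hrow, hcard]
    intro j
    exact (sum_eq_sum_iff_of_le fun j _ => hcol_le j).1 hs j (mem_univ j)
  have hbud : ∀ i, ∑ j, r' j * x' i j ≤ 0 := fun i => le_of_tendsto' (hlb i) fun m => hb (φ m) i
  refine ⟨x', μ', r', ⟨hx'0, hrow, hcol⟩, hμ'0, hr'n, fun i j k hj => ?_, hbud,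
    fun i hi => (hbud i).antisymm ?_, fun i j k hj hjk => ?_⟩
  · refine le_of_tendsto_of_tendsto (((hlμ i).mul (hlr k)).const_sub _)
      (((hlμ i).mul (hlr j)).const_sub _) ?_
    filter_upwards [(hlx i j).eventually_const_lt hj] with m hm using hopt (φ m) i j k hm
  · refine ge_of_tendsto (hlb i) ?_
    filter_upwards [hlε.eventually_lt (hlμ i) hi] with m hm using hb' (φ m) i hm
  · refine le_of_tendsto_of_tendsto (hlr j) (hlr k) ?_
    filter_upwards [(hlx i j).eventually_const_lt hj] with m hm
    have h1 := hopt (φ m) i j k hm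
    exact le_of_mul_le_mul_left (by linarith) ((hε0 _).trans_le (hμ (φ m) i).1)

end Equilibrium

/-- An HZ earnings equilibrium always exists. -/
theorem hz_earnings_equilibrium_exists {A G : Type*} [Fintype A] [Fintype G]
    (hcard : Fintype.card A = Fintype.card G) (u : A → G → ℝ) :
    ∃ (x : A → G → ℝ) (q : G → ℝ), IsHZEarningsEquilibrium u x q := by
  rcases isEmpty_or_nonempty G with hG | hG
  · have hA : IsEmpty A := Fintype.card_eq_zero_iff.1 (hcard.trans Fintype.card_eq_zero)
    exact ⟨fun _ _ => 0, fun _ => 0, ⟨fun i => isEmptyElim i, fun i => isEmptyElim i,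
      fun j => isEmptyElim j⟩, fun j => isEmptyElim j, fun i => isEmptyElim i,
      fun i => isEmptyElim i⟩
  obtain ⟨x, μ, r, hx, hμ, hr, hopt, hb, hb0, htie⟩ := exists_complementary_equilibrium hcard u
  have hn : (0 : ℝ) < Fintype.card G := Nat.cast_pos.2 Fintype.card_pos
  let t : ℝ := (Fintype.card G : ℝ)⁻¹
  have ht : 0 < t := inv_pos.2 hn
  have hq : ∀ y : G → ℝ, ∑ j, y j = 1 → ∑ j, (1 - t * r j) * y j = 1 - t * ∑ j, r j * y j := by
    intro y hy
    nth_rw 2 [← hy]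
    rw [mul_sum, ← sum_sub_distrib]
    exact sum_congr rfl fun j _ => by ring
  refine ⟨x, fun j => 1 - t * r j, hx, fun j => ?_, fun i => ?_, fun i y hy hy1 hqy => ?_⟩
  · have : t * r j ≤ t * Fintype.card G := mul_le_mul_of_nonneg_left (hr j) ht.le
    rw [inv_mul_cancel₀ hn.ne'] at this
    linarith
  · rw [hq _ (hx.2.1 i)]
    nlinarith [hb i]
  rw [hq y hy1] at hqy ⊢
  rw [hq _ (hx.2.1 i)]
  have hry : ∑ j, r j * y j ≤ 0 := by
    by_contra! h
    nlinarith [mul_pos ht h]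
  have havg : ∀ (c : G → ℝ) (v : ℝ) (w : G → ℝ), (∀ j, 0 ≤ w j) → ∑ j, w j = 1 →
      (∀ j, 0 < w j → c j ≤ v) → ∑ j, c j * w j ≤ v := by
    intro c v w hw hw1 h
    calc ∑ j, c j * w j ≤ ∑ j, v * w j := sum_le_sum fun j _ => by
          rcases (hw j).eq_or_lt with h0 | h0
          · rw [← h0]; simp
          · exact mul_le_mul_of_nonneg_right (h j h0) h0.le
      _ = v := by rw [← mul_sum, hw1, mul_one]
  have hlag : ∀ w : G → ℝ, ∑ j, (u i j - μ i * r j) * w j =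
      ∑ j, u i j * w j - μ i * ∑ j, r j * w j := fun w => by
    rw [mul_sum, ← sum_sub_distrib]
    exact sum_congr rfl fun j _ => by ring
  have hmax : ∀ k, u i k - μ i * r k ≤ ∑ j, u i j * x i j - μ i * ∑ j, r j * x i j := fun k => by
    have := havg (fun j => -(u i j - μ i * r j)) (-(u i k - μ i * r k)) (x i) (hx.1 i) (hx.2.1 i)
      fun j hj => neg_le_neg (hopt i j k hj)
    simp only [neg_mul, sum_neg_distrib, hlag] at this
    linarith
  have hvalue := havg (fun j => u i j - μ i * r j) _ y hy hy1 fun k _ => hmax k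
  rw [hlag] at hvalue
  rcases (hμ i).eq_or_lt with h0 | hpos
  · rw [← h0] at hvalue
    simp only [← h0, zero_mul, sub_zero] at hvalue hmax hopt
    refine ⟨hvalue, fun heq => ?_⟩
    have hzero : ∑ k, (∑ j, u i j * x i j - u i k) * y k = 0 := by
      simp only [sub_mul, sum_sub_distrib, ← mul_sum, hy1, heq, mul_one, sub_self]
    rw [sum_eq_zero_iff_of_nonneg fun k _ => mul_nonneg (by linarith [hmax k]) (hy k)] at hzero
    have hcheap : ∀ k, 0 < y k → ∑ j, r j * x i j ≤ r k := fun k hk =>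
      havg r (r k) (x i) (hx.1 i) (hx.2.1 i) fun j hj => htie i j k hj (by
        have := (mul_eq_zero.1 (hzero k (mem_univ k))).resolve_right hk.ne'
        linarith [hmax j])
    have := havg (fun j => -r j) (-∑ j, r j * x i j) y hy hy1 fun k hk => neg_le_neg (hcheap k hk)
    simp only [neg_mul, sum_neg_distrib] at this
    nlinarith
  · rw [hb0 i hpos] at hvalue ⊢
    refine ⟨by nlinarith, fun heq => ?_⟩
    have : 0 ≤ ∑ j, r j * y j := by
      by_contra! h
      nlinarith [mul_pos_of_neg_of_neg h (neg_lt_zero.2 hpos)]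
    nlinarith
end

section
/- Suppose there are exactly two agents with positive demands d_1 and d_2 with d_1 + d_2 = |G|. Let x be a fractional allocation that maximizes the total utility ∑_{i∈{1,2}} u_i · x_i over all envy-free fractional allocations. Then x is envy-free and Pareto-optimal among all fractional allocations. -/
open Finset

/-- A fractional allocation for agents with demands. -/
def IsAllocation {A G : Type*} [Fintype A] [Fintype G]
    (d : A → ℝ) (x : A → G → ℝ) : Prop :=
  (∀ i j, 0 ≤ x i j) ∧ (∀ i, ∑ j, x i j = d i) ∧ (∀ j, ∑ i, x i j = 1)

/-- Envy-freeness with demands: envy is measured on a utility-per-demand basis. -/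
def EnvyFreeDemand {A G : Type*} [Fintype A] [Fintype G]
    (d : A → ℝ) (u : A → G → ℝ) (x : A → G → ℝ) : Prop :=
  ∀ i i' : A, (∑ j, u i j * x i' j) / d i' ≤ (∑ j, u i j * x i j) / d i

/-- Pareto-optimality among all fractional allocations with demands. -/
def ParetoOptimalDemand {A G : Type*} [Fintype A] [Fintype G]
    (d : A → ℝ) (u : A → G → ℝ) (x : A → G → ℝ) : Prop :=
  ¬ ∃ y : A → G → ℝ, IsAllocation d y ∧
    (∀ i, ∑ j, u i j * x i j ≤ ∑ j, u i j * y i j) ∧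
    (∃ i, ∑ j, u i j * x i j < ∑ j, u i j * y i j)

/-- The values of the bundles of an allocation add up to the value of the set of all items. -/
lemma IsAllocation.sum_mul_eq {A G : Type*} [Fintype A] [Fintype G] {d : A → ℝ}
    {x : A → G → ℝ} (hx : IsAllocation d x) (v : G → ℝ) :
    ∑ i, ∑ j, v j * x i j = ∑ j, v j := by
  rw [Finset.sum_comm]
  simp only [← Finset.mul_sum, hx.2.2, mul_one]

/-- With two agents, envy-freeness is preserved when no agent's utility decreases. -/
lemma EnvyFreeDemand.of_le_two_agents {G : Type*} [Fintype G] {d : Fin 2 → ℝ}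
    (hd : ∀ i, 0 ≤ d i) {u x y : Fin 2 → G → ℝ} (hx : IsAllocation d x)
    (hy : IsAllocation d y) (hxef : EnvyFreeDemand d u x)
    (hle : ∀ i, ∑ j, u i j * x i j ≤ ∑ j, u i j * y i j) : EnvyFreeDemand d u y := by
  have htotal (i : Fin 2) := (hx.sum_mul_eq (u i)).trans (hy.sum_mul_eq (u i)).symm
  simp only [Fin.sum_univ_two] at htotal
  intro i i'
  obtain rfl | hne := eq_or_ne i i'
  · exact le_rfl
  have hother : ∑ j, u i j * y i' j ≤ ∑ j, u i j * x i' j := by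
    have ht := htotal i
    have hi := hle i
    fin_cases i <;> fin_cases i' <;> simp at hne ht hi ⊢ <;> linarith
  calc
    (∑ j, u i j * y i' j) / d i' ≤ (∑ j, u i j * x i' j) / d i' :=
      div_le_div_of_nonneg_right hother (hd i')
    _ ≤ (∑ j, u i j * x i j) / d i := hxef i i'
    _ ≤ (∑ j, u i j * y i j) / d i := div_le_div_of_nonneg_right (hle i) (hd i)

/-- With two agents, an allocation maximizing total utility over all
envy-free allocations is envy-free and Pareto-optimal among all allocations. -/
theorem max_welfare_envyFree_is_EF_PO_two_agents {G : Type*} [Fintype G]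
    (d : Fin 2 → ℝ) (hd : ∀ i, 0 < d i) (hdsum : d 0 + d 1 = (Fintype.card G : ℝ))
    (u : Fin 2 → G → ℝ) (x : Fin 2 → G → ℝ)
    (hx : IsAllocation d x) (hxef : EnvyFreeDemand d u x)
    (hmax : ∀ y : Fin 2 → G → ℝ, IsAllocation d y → EnvyFreeDemand d u y →
      (∑ i, ∑ j, u i j * y i j) ≤ (∑ i, ∑ j, u i j * x i j)) :
    EnvyFreeDemand d u x ∧ ParetoOptimalDemand d u x := by
  refine ⟨hxef, ?_⟩
  rintro ⟨y, hy, hle, i, hi⟩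
  have hyef := hxef.of_le_two_agents (fun i ↦ (hd i).le) hx hy hle
  exact (hmax y hy hyef).not_gt
    (Finset.sum_lt_sum (fun i _ ↦ hle i) ⟨i, Finset.mem_univ i, hi⟩)
end
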